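/- arXiv:2112.04045 — 3 statements merged into one kernel-verified Lean document; each statement's English description precedes it below -/
import Mathlib

section
/- Assume the costs are nonnegative, i.e. c(u,v) ≥ 0 and q(u,v,w) ≥ 0 for all u,v,w ∈ V, and assume there exists at least one walk from s to t. Then there exists a walk from s to t of minimum quadratic cost; that is, the infimum of C over all walks from s to t is attained by some walk (even though infinitely many walks from s to t may exist). -/
/-- Linear cost of a walk: sum of `c` over consecutive pairs of vertices. -/
def linCost {V : Type*} (c : V → V → ℝ) : List V → ℝ
  | u :: v :: rest => c u v + linCost c (v :: rest)
  | _ => 0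

/-- Quadratic interaction cost of a walk: sum of `q` over consecutive triples. -/
def quadCost {V : Type*} (q : V → V → V → ℝ) : List V → ℝ
  | u :: v :: x :: rest => q u v x + quadCost q (v :: x :: rest)
  | _ => 0

/-- Total (quadratic) cost `C` of a walk. -/
def cost {V : Type*} (c : V → V → ℝ) (q : V → V → V → ℝ) (w : List V) : ℝ :=
  linCost c w + quadCost q w

/-- A walk from `s` to `t`: a nonempty vertex sequence starting at `s`, ending at `t`,
whose consecutive pairs are arcs. -/
def IsWalk {V : Type*} (A : V → V → Prop) (s t : V) (w : List V) : Prop :=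
  w ≠ [] ∧ w.head? = some s ∧ w.getLast? = some t ∧ w.Chain' A

/-- A path: a walk with pairwise distinct vertices. -/
def IsPath {V : Type*} (A : V → V → Prop) (s t : V) (w : List V) : Prop :=
  IsWalk A s t w ∧ w.Nodup

/-- An α-cycle: a walk `(u₁, …, uₙ)` with `n ≥ 5` and `u₂ = u_{n-1}`. -/
def IsAlphaCycle {V : Type*} (A : V → V → Prop) (w : List V) : Prop :=
  5 ≤ w.length ∧ w.Chain' A ∧ w[1]? = w[w.length - 2]?

/-- An improving α-cycle: an α-cycle `(u₁, …, uₙ)` with `C((u₁,…,uₙ)) < C((u₁,u₂,uₙ))`. -/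
def IsImprovingAlphaCycle {V : Type*} (A : V → V → Prop) (c : V → V → ℝ)
    (q : V → V → V → ℝ) (w : List V) : Prop :=
  IsAlphaCycle A w ∧ ∃ u1 u2 un, w[0]? = some u1 ∧ w[1]? = some u2 ∧
    w.getLast? = some un ∧ cost c q w < cost c q [u1, u2, un]

/-- The finitely many values of the linear and the quadratic cost functions. -/
def costValues {V : Type*} (c : V → V → ℝ) (q : V → V → V → ℝ) : Set ℝ :=
  Set.range (fun p : V × V => c p.1 p.2) ∪ Set.range (fun p : V × V × V => q p.1 p.2.1 p.2.2)

lemma linCost_mem_closure {V : Type*} (c : V → V → ℝ) (q : V → V → V → ℝ) (w : List V) :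
    linCost c w ∈ AddSubmonoid.closure (costValues c q) := by
  fun_induction linCost c w with
  | case1 u v rest ih =>
    exact add_mem (AddSubmonoid.subset_closure (Or.inl ⟨(u, v), rfl⟩)) ih
  | case2 => exact zero_mem _

lemma quadCost_mem_closure {V : Type*} (c : V → V → ℝ) (q : V → V → V → ℝ) (w : List V) :
    quadCost q w ∈ AddSubmonoid.closure (costValues c q) := by
  fun_induction quadCost q w with
  | case1 u v x rest ih =>
    exact add_mem (AddSubmonoid.subset_closure (Or.inr ⟨(u, v, x), rfl⟩)) ih
  | case2 => exact zero_mem _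

lemma cost_mem_closure {V : Type*} (c : V → V → ℝ) (q : V → V → V → ℝ) (w : List V) :
    cost c q w ∈ AddSubmonoid.closure (costValues c q) :=
  add_mem (linCost_mem_closure c q w) (quadCost_mem_closure c q w)

/-- A finite set of nonnegative reals generates a well-ordered additive submonoid, so the costs
of walks are well-ordered. -/
lemma isWF_range_cost {V : Type*} [Finite V] (c : V → V → ℝ) (q : V → V → V → ℝ)
    (hc : ∀ u v, 0 ≤ c u v) (hq : ∀ u v x, 0 ≤ q u v x) : (Set.range (cost c q)).IsWF := by
  have hfin : (costValues c q).Finite := (Set.finite_range _).union (Set.finite_range _)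
  have hnonneg : ∀ x ∈ costValues c q, 0 ≤ x := by
    rintro x (⟨p, rfl⟩ | ⟨p, rfl⟩)
    exacts [hc _ _, hq _ _ _]
  refine (Set.IsPWO.addSubmonoid_closure hnonneg hfin.isPWO).isWF.mono ?_
  rintro _ ⟨w, rfl⟩
  exact cost_mem_closure c q w

/-- with nonnegative costs, if some walk from `s` to `t` exists then
there is a walk from `s` to `t` of minimum quadratic cost. -/
theorem exists_min_cost_walk {V : Type*} [Fintype V] (A : V → V → Prop)
    (c : V → V → ℝ) (q : V → V → V → ℝ)
    (hc : ∀ u v, 0 ≤ c u v) (hq : ∀ u v x, 0 ≤ q u v x)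
    (s t : V) (hex : ∃ w, IsWalk A s t w) :
    ∃ w, IsWalk A s t w ∧ ∀ w', IsWalk A s t w' → cost c q w ≤ cost c q w' := by
  have hwf : (cost c q '' {w | IsWalk A s t w}).IsWF :=
    (isWF_range_cost c q hc hq).mono (Set.image_subset_range _ _)
  have hne : (cost c q '' {w | IsWalk A s t w}).Nonempty := Set.Nonempty.image _ hex
  obtain ⟨w, hw, hmin⟩ := hwf.min_mem hne
  exact ⟨w, hw, fun w' hw' => hmin ▸ hwf.min_le hne ⟨w', hw', rfl⟩⟩
end

section
/- Assume the costs are nonnegative, i.e. c(u,v) ≥ 0 and q(u,v,w) ≥ 0 for all u,v,w ∈ V. Let (j,k) ∈ A be an arc with j ≠ s such that some s-(j,k)-walk exists. Then the set of arcs (i,j) ∈ A for which an s-(i,j)-walk exists is nonempty, and W((j,k)) = inf { W((i,j)) + c(j,k) + q(i,j,k) : (i,j) ∈ A and some s-(i,j)-walk exists } (the dynamic-programming recursion underlying the adjacent quadratic Dijkstra algorithm). -/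
/-- An `s`-`a`-walk for the arc `a = (i,j)`: a walk from `s` to `j` whose
second-to-last vertex is `i`. -/
def IsArcWalk {V : Type*} (A : V → V → Prop) (s i j : V) (w : List V) : Prop :=
  IsWalk A s j w ∧ 2 ≤ w.length ∧ w[w.length - 2]? = some i

/-- `W((i,j))`: the infimum of the quadratic cost over all `s`-`(i,j)`-walks. -/
noncomputable def arcDist {V : Type*} (A : V → V → Prop) (c : V → V → ℝ)
    (q : V → V → V → ℝ) (s i j : V) : ℝ :=
  sInf {x : ℝ | ∃ w, IsArcWalk A s i j w ∧ cost c q w = x}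

theorem linCost_nonneg {V : Type*} {c : V → V → ℝ} (hc : ∀ u v, 0 ≤ c u v) :
    ∀ w : List V, 0 ≤ linCost c w
  | [] => le_rfl
  | [_] => le_rfl
  | u :: v :: rest => add_nonneg (hc u v) (linCost_nonneg hc (v :: rest))

theorem quadCost_nonneg {V : Type*} {q : V → V → V → ℝ} (hq : ∀ u v x, 0 ≤ q u v x) :
    ∀ w : List V, 0 ≤ quadCost q w
  | [] => le_rfl
  | [_] => le_rfl
  | [_, _] => le_rfl
  | u :: v :: x :: rest => add_nonneg (hq u v x) (quadCost_nonneg hq (v :: x :: rest))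

theorem cost_nonneg {V : Type*} {c : V → V → ℝ} {q : V → V → V → ℝ}
    (hc : ∀ u v, 0 ≤ c u v) (hq : ∀ u v x, 0 ≤ q u v x) (w : List V) : 0 ≤ cost c q w :=
  add_nonneg (linCost_nonneg hc w) (quadCost_nonneg hq w)

theorem linCost_append_pair {V : Type*} (c : V → V → ℝ) (j k : V) :
    ∀ p : List V, linCost c (p ++ [j, k]) = linCost c (p ++ [j]) + c j k
  | [] => by simp [linCost]
  | [a] => by simp [linCost]
  | a :: b :: p => by
    have ih := linCost_append_pair c j k (b :: p)
    simp only [List.cons_append, linCost] at ih ⊢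
    rw [ih, add_assoc]

theorem quadCost_append_triple {V : Type*} (q : V → V → V → ℝ) (i j k : V) :
    ∀ p : List V, quadCost q (p ++ [i, j, k]) = quadCost q (p ++ [i, j]) + q i j k
  | [] => by simp [quadCost]
  | [a] => by simp [quadCost]
  | [a, b] => by simp [quadCost, add_assoc]
  | a :: b :: d :: p => by
    have ih := quadCost_append_triple q i j k (b :: d :: p)
    simp only [List.cons_append, quadCost] at ih ⊢
    rw [ih, add_assoc]

/-- An `s`-`(i,j)`-walk is a chain of arcs from `s` whose last two vertices are `i`, `j`. -/
theorem isArcWalk_iff {V : Type*} {A : V → V → Prop} {s i j : V} {w : List V} :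
    IsArcWalk A s i j w ↔
      ∃ p, w = p ++ [i, j] ∧ (p ++ [i]).head? = some s ∧ (p ++ [i, j]).IsChain A := by
  constructor
  · rintro ⟨⟨-, hs, hj, hA⟩, h2, hi⟩
    obtain ⟨r, rfl⟩ := List.getLast?_eq_some_iff.mp hj
    have hr : r.getLast? = some i := by
      simp only [List.length_append, List.length_singleton] at h2 hi
      rw [List.getLast?_eq_getElem?, ← hi, List.getElem?_append_left (by omega)]
      congr 1
    obtain ⟨p, rfl⟩ := List.getLast?_eq_some_iff.mp hr
    refine ⟨p, by simp, ?_, by simpa [List.Chain'] using hA⟩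
    cases p <;> simpa using hs
  · rintro ⟨p, rfl, hs, hA⟩
    refine ⟨⟨by simp, ?_, by simp, hA⟩, by simp, by simp⟩
    cases p <;> simpa using hs

theorem IsArcWalk.adj {V : Type*} {A : V → V → Prop} {s i j : V} {w : List V}
    (h : IsArcWalk A s i j w) : A i j := by
  obtain ⟨p, -, -, hA⟩ := isArcWalk_iff.mp h
  exact (List.isChain_append_cons_cons.mp hA).2.1

theorem IsArcWalk.append_singleton {V : Type*} {A : V → V → Prop} {s i j k : V} {w : List V}
    (h : IsArcWalk A s i j w) (hjk : A j k) : IsArcWalk A s j k (w ++ [k]) := by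
  obtain ⟨p, rfl, hs, hA⟩ := isArcWalk_iff.mp h
  refine isArcWalk_iff.mpr ⟨p ++ [i], by simp, ?_, ?_⟩
  · cases p <;> simpa using hs
  · have := List.isChain_append_cons_cons.mp hA
    simp only [List.append_assoc, List.cons_append, List.nil_append]
    exact List.isChain_append_cons_cons.mpr ⟨this.1, this.2.1, by simpa using hjk⟩

theorem IsArcWalk.exists_eq_append_singleton {V : Type*} {A : V → V → Prop} {s j k : V}
    {w : List V} (h : IsArcWalk A s j k w) (hjs : j ≠ s) :
    ∃ i w', IsArcWalk A s i j w' ∧ w = w' ++ [k] := by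
  obtain ⟨p, rfl, hs, hA⟩ := isArcWalk_iff.mp h
  rcases List.eq_nil_or_concat' p with rfl | ⟨r, i, rfl⟩
  · exact absurd (by simpa using hs) hjs
  · refine ⟨i, r ++ [i, j], isArcWalk_iff.mpr ⟨r, rfl, ?_, ?_⟩, by simp⟩
    · cases r <;> simpa using hs
    · have : ((r ++ [i, j]) ++ [k]).IsChain A := by simpa using hA
      exact this.left_of_append

theorem IsArcWalk.cost_append_singleton {V : Type*} {A : V → V → Prop} {s i j : V} {w : List V}
    (h : IsArcWalk A s i j w) (c : V → V → ℝ) (q : V → V → V → ℝ) (k : V) :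
    cost c q (w ++ [k]) = cost c q w + c j k + q i j k := by
  obtain ⟨p, rfl, -, -⟩ := isArcWalk_iff.mp h
  have hlin := linCost_append_pair c j k (p ++ [i])
  have hquad := quadCost_append_triple q i j k p
  simp only [List.append_assoc, List.cons_append, List.nil_append] at hlin ⊢
  rw [cost, cost, hlin, hquad]
  ring

theorem arcDist_nonneg {V : Type*} {A : V → V → Prop} {c : V → V → ℝ} {q : V → V → V → ℝ}
    (hc : ∀ u v, 0 ≤ c u v) (hq : ∀ u v x, 0 ≤ q u v x) (s i j : V) :
    0 ≤ arcDist A c q s i j :=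
  Real.sInf_nonneg (by rintro _ ⟨w, -, rfl⟩; exact cost_nonneg hc hq w)

theorem IsArcWalk.arcDist_le {V : Type*} {A : V → V → Prop} {c : V → V → ℝ}
    {q : V → V → V → ℝ} (hc : ∀ u v, 0 ≤ c u v) (hq : ∀ u v x, 0 ≤ q u v x) {s i j : V}
    {w : List V} (h : IsArcWalk A s i j w) : arcDist A c q s i j ≤ cost c q w :=
  csInf_le ⟨0, by rintro _ ⟨w, -, rfl⟩; exact cost_nonneg hc hq w⟩ ⟨w, h, rfl⟩

/-- the dynamic-programming recursion. With nonnegative costs, for an arc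
`(j,k)` with `j ≠ s` reachable by some `s`-`(j,k)`-walk, the set of incoming arcs
`(i,j)` reachable from `s` is nonempty and
`W((j,k)) = inf { W((i,j)) + c(j,k) + q(i,j,k) }` over those arcs. -/
theorem arcDist_recursion {V : Type*} [Fintype V] (A : V → V → Prop)
    (c : V → V → ℝ) (q : V → V → V → ℝ)
    (hc : ∀ u v, 0 ≤ c u v) (hq : ∀ u v x, 0 ≤ q u v x)
    (s j k : V) (hjk : A j k) (hjs : j ≠ s)
    (hex : ∃ w, IsArcWalk A s j k w) :
    (∃ i, A i j ∧ ∃ w, IsArcWalk A s i j w) ∧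
    arcDist A c q s j k =
      sInf {x : ℝ | ∃ i, A i j ∧ (∃ w, IsArcWalk A s i j w) ∧
        x = arcDist A c q s i j + c j k + q i j k} := by
  obtain ⟨w₀, hw₀⟩ := hex
  obtain ⟨i₀, v₀, hv₀, -⟩ := hw₀.exists_eq_append_singleton hjs
  refine ⟨⟨i₀, hv₀.adj, v₀, hv₀⟩, le_antisymm ?_ ?_⟩
  · refine le_csInf ⟨_, i₀, hv₀.adj, ⟨v₀, hv₀⟩, rfl⟩ ?_
    rintro _ ⟨i, -, ⟨v, hv⟩, rfl⟩
    have : arcDist A c q s j k - c j k - q i j k ≤ arcDist A c q s i j := by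
      refine le_csInf ⟨_, v, hv, rfl⟩ ?_
      rintro _ ⟨w, hw, rfl⟩
      have hle := (hw.append_singleton hjk).arcDist_le hc hq
      rw [hw.cost_append_singleton] at hle
      linarith
    linarith
  · refine le_csInf ⟨_, w₀, hw₀, rfl⟩ ?_
    rintro _ ⟨w, hw, rfl⟩
    obtain ⟨i, v, hv, rfl⟩ := hw.exists_eq_append_singleton hjs
    rw [hv.cost_append_singleton]
    have hle := hv.arcDist_le hc hq
    refine le_trans (b := arcDist A c q s i j + c j k + q i j k)
      (csInf_le ⟨0, ?_⟩ ⟨i, hv.adj, ⟨v, hv⟩, rfl⟩) (by linarith)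
    rintro _ ⟨i', -, -, rfl⟩
    exact add_nonneg (add_nonneg (arcDist_nonneg hc hq s i' j) (hc j k)) (hq i' j k)
end

section
/- Let s ≠ t, define the quadratic arc-pair cost Q((u,v),(x,y)) = q(u,v,y) if v = x and Q((u,v),(x,y)) = 0 if v ≠ x, and let P = (w₁,…,wₙ) be a path from s to t with indicator vector x : A → {0,1} (x(a) = 1 exactly when a is an arc of P). Then the binary quadratic program objective evaluated at x equals the quadratic cost of P: Σ_{a ∈ A} c(a)·x(a) + Σ_{(a,b) ∈ A×A} Q(a,b)·x(a)·x(b) = C(P). -/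
theorem List.IsChain.rel_of_mem_zip_tail {V : Type*} {A : V → V → Prop} {w : List V}
    (h : w.IsChain A) {a : V × V} (ha : a ∈ w.zip w.tail) : A a.1 a.2 := by
  induction w with
  | nil => simp at ha
  | cons u l ih =>
    cases l with
    | nil => simp at ha
    | cons v rest =>
      rw [List.isChain_cons_cons] at h
      simp only [List.tail_cons, List.zip_cons_cons, List.mem_cons] at ha
      rcases ha with rfl | ha
      · exact h.1
      · exact ih h.2 ha

theorem List.Nodup.zip_tail {V : Type*} {w : List V} (h : w.Nodup) :
    (w.zip w.tail).Nodup := by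
  induction w with
  | nil => simp
  | cons u l ih =>
    cases l with
    | nil => simp
    | cons v rest =>
      rw [List.nodup_cons] at h
      exact List.nodup_cons.2 ⟨fun hm => h.1 (List.of_mem_zip hm).1, ih h.2⟩

theorem sum_map_zip_tail_eq_linCost {V : Type*} (c : V → V → ℝ) (w : List V) :
    ((w.zip w.tail).map fun a => c a.1 a.2).sum = linCost c w := by
  induction w with
  | nil => simp [linCost]
  | cons u l ih =>
    cases l with
    | nil => simp [linCost]
    | cons v rest =>
      simp only [List.tail_cons] at ih
      simp [linCost, ← ih]

theorem sum_map_zip_tail_eq_zero {V : Type*} [DecidableEq V] (f : V × V → ℝ) {v : V}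
    {l : List V} (hv : v ∉ l) :
    ((l.zip l.tail).map fun b => if v = b.1 then f b else 0).sum = 0 := by
  refine List.sum_eq_zero fun y hy => ?_
  obtain ⟨b, hb, rfl⟩ := List.mem_map.1 hy
  exact if_neg fun h : v = b.1 => hv (h ▸ (List.of_mem_zip hb).1)

/-- The double sum of arc-pair costs over the arcs of a duplicate-free vertex list. -/
theorem sum_sum_map_zip_tail_eq_quadCost {V : Type*} [DecidableEq V] (q : V → V → V → ℝ)
    {w : List V} (hw : w.Nodup) :
    ((w.zip w.tail).map fun a => ((w.zip w.tail).map fun b =>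
      if a.2 = b.1 then q a.1 a.2 b.2 else 0).sum).sum = quadCost q w := by
  induction w with
  | nil => simp [quadCost]
  | cons u l ih =>
    cases l with
    | nil => simp [quadCost]
    | cons v rest =>
      have hu : u ∉ v :: rest := (List.nodup_cons.1 hw).1
      have hl : (v :: rest).Nodup := (List.nodup_cons.1 hw).2
      have ih := ih hl
      have hvu : v ≠ u := fun h => hu (h ▸ List.mem_cons_self)
      have hback : (((v :: rest).zip rest).map fun a : V × V =>
          if a.2 = u then q a.1 a.2 v else 0).sum = 0 := by
        refine List.sum_eq_zero fun y hy => ?_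
        obtain ⟨b, hb, rfl⟩ := List.mem_map.1 hy
        exact if_neg fun h : b.2 = u => hu (h ▸ List.mem_cons_of_mem _ (List.of_mem_zip hb).2)
      simp only [List.tail_cons] at ih
      simp only [List.tail_cons, List.zip_cons_cons, List.map_cons, List.sum_cons,
        List.sum_map_add, hback, ih, if_neg hvu, zero_add]
      cases rest with
      | nil => simp [quadCost]
      | cons x rest =>
        have hv := sum_map_zip_tail_eq_zero (fun b => q u v b.2) (List.nodup_cons.1 hl).1
        simp only [List.tail_cons] at hv
        simp [quadCost, hv]

/-- the binary quadratic program objective, evaluated at the arc-indicator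
vector of an `s`-`t`-path `P` (with `s ≠ t`), equals the quadratic cost `C(P)`, where
`Q((u,v),(x,y)) = q(u,v,y)` if `v = x` and `0` otherwise. -/
theorem bqp_objective_eq_cost {V : Type*} [Fintype V] [DecidableEq V]
    (A : V → V → Prop) [DecidableRel A]
    (c : V → V → ℝ) (q : V → V → V → ℝ)
    (s t : V) (hst : s ≠ t) (w : List V) (hw : IsPath A s t w)
    (x : V × V → ℝ)
    (hx : ∀ a : V × V, x a = if a ∈ w.zip w.tail then 1 else 0) :
    (∑ a ∈ Finset.univ.filter (fun a : V × V => A a.1 a.2), c a.1 a.2 * x a) +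
      (∑ p ∈ Finset.univ.filter
          (fun p : (V × V) × V × V => A p.1.1 p.1.2 ∧ A p.2.1 p.2.2),
        (if p.1.2 = p.2.1 then q p.1.1 p.1.2 p.2.2 else 0) * x p.1 * x p.2) =
    cost c q w := by
  obtain ⟨⟨-, -, -, hchain⟩, hnd⟩ := hw
  have hA : ∀ a ∈ w.zip w.tail, A a.1 a.2 := fun a ha =>
    List.IsChain.rel_of_mem_zip_tail hchain ha
  have hL := hnd.zip_tail
  unfold cost
  congr 1
  · rw [← sum_map_zip_tail_eq_linCost, ← List.sum_toFinset _ hL]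
    symm
    refine Finset.sum_subset_zero_on_sdiff (fun a ha => ?_) (fun a ha => ?_) fun a ha => ?_
    · simpa using hA a (List.mem_toFinset.1 ha)
    · simp only [Finset.mem_sdiff, List.mem_toFinset] at ha
      simp [hx, ha.2]
    · simp [hx, List.mem_toFinset.1 ha]
  · rw [← sum_sum_map_zip_tail_eq_quadCost q hnd, ← List.sum_toFinset _ hL]
    simp only [← List.sum_toFinset _ hL]
    rw [← Finset.sum_product']
    symm
    refine Finset.sum_subset_zero_on_sdiff (fun p hp => ?_) (fun p hp => ?_) fun p hp => ?_
    · simp only [Finset.mem_product, List.mem_toFinset] at hp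
      simpa using ⟨hA _ hp.1, hA _ hp.2⟩
    · simp only [Finset.mem_sdiff, Finset.mem_product, List.mem_toFinset, not_and_or] at hp
      rcases hp.2 with h | h <;> simp [hx, h]
    · simp only [Finset.mem_product, List.mem_toFinset] at hp
      simp [hx, hp.1, hp.2]
end
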